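/- arXiv:2204.05429 — 2 statements merged into one kernel-verified Lean document; each statement's English description precedes it below -/
import Mathlib

section
/- Let n ∈ ℕ, k ∈ {0,…,n}, Δ ≥ 0, x ∈ k𝔹₀, w ∈ ℝⁿ, and set C := k𝔹₀ ∩ (x + Δ𝔹∞). Let ℓ(x) := {i : |x_i| > Δ} (so ℓ(x) ⊆ supp(x) and |ℓ(x)| ≤ k), let ŷ_i := max(x_i − Δ, min(w_i, x_i + Δ)) and z_i := w_i² − (w_i − ŷ_i)². Then min{‖w − y‖₂² : y ∈ C} = ‖w‖₂² − max{ Σ_{i∈S} z_i : S ⊆ {1,…,n}, |S| = k, ℓ(x) ⊆ S }. -/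
open Finset

noncomputable section

/-- The `ℓ∞` ball of radius `Δ` centered at `x`: `x + Δ𝔹∞`. -/
def box (n : ℕ) (x : Fin n → ℝ) (Δ : ℝ) : Set (Fin n → ℝ) :=
  {y | ∀ i, |y i - x i| ≤ Δ}

/-- The zero-norm ball `k𝔹₀`: vectors with at most `k` nonzero components. -/
def sparse (n k : ℕ) : Set (Fin n → ℝ) :=
  {y | (Finset.univ.filter (fun i => y i ≠ 0)).card ≤ k}

/-- The piece `A_S`: vectors supported in `S`. -/
def AS {n : ℕ} (S : Finset (Fin n)) : Set (Fin n → ℝ) :=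
  {y | ∀ i, i ∉ S → y i = 0}

/-- Squared Euclidean distance. -/
def distSq {n : ℕ} (w y : Fin n → ℝ) : ℝ := ∑ i, (w i - y i) ^ 2

/-- The set of projections (closest points in the Euclidean norm) of `w` into `A`. -/
def projSet {n : ℕ} (w : Fin n → ℝ) (A : Set (Fin n → ℝ)) : Set (Fin n → ℝ) :=
  {y | y ∈ A ∧ ∀ z ∈ A, distSq w y ≤ distSq w z}

/-- The clamp of `w` to `[x - Δ, x + Δ]` is a nearest point of that interval to `w`. -/
theorem sq_sub_clamp_le {x w y Δ : ℝ} (h : |y - x| ≤ Δ) :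
    (w - max (x - Δ) (min w (x + Δ))) ^ 2 ≤ (w - y) ^ 2 := by
  obtain ⟨h1, h2⟩ := abs_le.mp h
  apply sq_le_sq.mpr
  grind

theorem abs_clamp_sub_le {x w Δ : ℝ} (hΔ : 0 ≤ Δ) :
    |max (x - Δ) (min w (x + Δ)) - x| ≤ Δ := by
  grind

theorem sum_sq_sub_sum_eq {ι : Type*} [Fintype ι] [DecidableEq ι] (w y : ι → ℝ) (S : Finset ι) :
    ∑ i, (w i) ^ 2 - ∑ i ∈ S, ((w i) ^ 2 - (w i - y i) ^ 2) =
      ∑ i, (w i - if i ∈ S then y i else 0) ^ 2 := by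
  have h : ∑ i ∈ S, ((w i) ^ 2 - (w i - y i) ^ 2) =
      ∑ i, if i ∈ S then (w i) ^ 2 - (w i - y i) ^ 2 else 0 := by simp
  rw [h, ← Finset.sum_sub_distrib]
  refine Finset.sum_congr rfl fun i _ => ?_
  split_ifs <;> ring

/-- `min{‖w − y‖₂² : y ∈ C} = ‖w‖₂² − max{Σ_{i∈S} z_i : |S| = k, ℓ(x) ⊆ S}`,
where `ℓ(x) = {i : |x i| > Δ}`, `ŷ` is the clamp of `w` to the box and
`z_i = w_i² − (w_i − ŷ_i)²`. -/
theorem stmt10 (n k : ℕ) (hkn : k ≤ n) (Δ : ℝ) (hΔ : 0 ≤ Δ)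
    (x : Fin n → ℝ) (hx : x ∈ sparse n k) (w : Fin n → ℝ)
    (yhat z : Fin n → ℝ)
    (hyhat : ∀ i, yhat i = max (x i - Δ) (min (w i) (x i + Δ)))
    (hz : ∀ i, z i = (w i) ^ 2 - (w i - yhat i) ^ 2) :
    sInf {d : ℝ | ∃ y ∈ sparse n k ∩ box n x Δ, d = distSq w y} =
      (∑ i, (w i) ^ 2) -
        sSup {t : ℝ | ∃ S : Finset (Fin n), S.card = k ∧
          (∀ i, Δ < |x i| → i ∈ S) ∧ t = ∑ i ∈ S, z i} := by
  have hexists : ∀ T : Finset (Fin n), T.card ≤ k → ∃ S, T ⊆ S ∧ S.card = k := fun T hT =>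
    Finset.exists_superset_card_eq hT (by simpa using hkn)
  set A : Set ℝ := {t : ℝ | ∃ S : Finset (Fin n), S.card = k ∧
          (∀ i, Δ < |x i| → i ∈ S) ∧ t = ∑ i ∈ S, z i}
  have hfin : A.Finite := by
    refine (Set.finite_range fun S : Finset (Fin n) => ∑ i ∈ S, z i).subset ?_
    rintro _ ⟨S, -, -, rfl⟩
    exact ⟨S, rfl⟩
  have hne : A.Nonempty := by
    obtain ⟨S, hS, hc⟩ := hexists _ hx
    refine ⟨_, S, hc, fun i hi => hS ?_, rfl⟩
    simpa using abs_pos.mp (hΔ.trans_lt hi)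
  have hsum : ∀ S : Finset (Fin n), ∑ i, (w i) ^ 2 - ∑ i ∈ S, z i =
      ∑ i, (w i - if i ∈ S then yhat i else 0) ^ 2 := fun S => by
    simp only [hz, sum_sq_sub_sum_eq]
  refine IsLeast.csInf_eq ⟨?_, ?_⟩
  · obtain ⟨S, hc, hl, hS⟩ := hne.csSup_mem hfin
    refine ⟨fun i => if i ∈ S then yhat i else 0, ⟨?_, fun i => ?_⟩, ?_⟩
    · refine (Finset.card_le_card fun i hi => ?_).trans hc.le
      by_contra h
      simp [h] at hi
    · dsimp only
      split_ifs with h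
      · rw [hyhat]
        exact abs_clamp_sub_le hΔ
      · simpa using not_lt.mp (mt (hl i) h)
    · rw [hS, hsum, distSq]
  · rintro _ ⟨y, ⟨hy, hb⟩, rfl⟩
    obtain ⟨S, hS, hc⟩ := hexists _ hy
    have hzero : ∀ i, i ∉ S → y i = 0 := fun i hi => by
      by_contra h
      exact hi (hS (by simpa using h))
    have hmem : ∑ i ∈ S, z i ∈ A := by
      refine ⟨S, hc, fun i hi => ?_, rfl⟩
      by_contra h
      have := hb i
      rw [hzero i h, zero_sub, abs_neg] at this
      exact this.not_gt hi
    calc _ ≤ ∑ i, (w i) ^ 2 - ∑ i ∈ S, z i := sub_le_sub_left (le_csSup hfin.bddAbove hmem) _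
      _ = ∑ i, (w i - if i ∈ S then yhat i else 0) ^ 2 := hsum S
      _ ≤ distSq w y := Finset.sum_le_sum fun i _ => by
        split_ifs with h
        · rw [hyhat]
          exact sq_sub_clamp_le (hb i)
        · rw [hzero i h]
end
end

section
/- Let n ∈ ℕ, k ∈ {0,…,n}, Δ ≥ 0, x ∈ k𝔹₀, and set C := k𝔹₀ ∩ (x + Δ𝔹∞). Then C is nonempty and closed, and for every w ∈ ℝⁿ the set P(w) of projections of w into C is nonempty and finite. -/
open Finset

noncomputable section

theorem sparse_eq_iUnion_AS (n k : ℕ) :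
    sparse n k = ⋃ S ∈ {S : Finset (Fin n) | S.card ≤ k}, AS S := by
  ext y
  simp only [Set.mem_iUnion, Set.mem_ofPred_eq, exists_prop]
  constructor
  · intro hy
    refine ⟨Finset.univ.filter (fun i => y i ≠ 0), hy, fun i hi => ?_⟩
    simpa using hi
  · rintro ⟨S, hS, hy⟩
    refine le_trans (Finset.card_le_card fun i hi => ?_) hS
    by_contra h
    exact (Finset.mem_filter.mp hi).2 (hy i h)

theorem isClosed_AS {n : ℕ} (S : Finset (Fin n)) : IsClosed (AS S) := by
  simp only [AS, Set.ofPred_forall]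
  exact isClosed_iInter fun i => isClosed_iInter fun _ =>
    isClosed_eq (continuous_apply i) continuous_const

theorem isClosed_sparse (n k : ℕ) : IsClosed (sparse n k) := by
  rw [sparse_eq_iUnion_AS]
  exact (Set.toFinite _).isClosed_biUnion fun S _ => isClosed_AS S

theorem box_eq_Icc (n : ℕ) (x : Fin n → ℝ) (Δ : ℝ) :
    box n x Δ = Set.Icc (fun i => x i - Δ) (fun i => x i + Δ) := by
  ext y
  simp only [_root_.box, Set.mem_ofPred_eq, Set.mem_Icc, Pi.le_def, ← forall_and]
  refine forall_congr' fun i => ?_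
  rw [abs_le]
  constructor <;> rintro ⟨h₁, h₂⟩ <;> constructor <;> linarith

theorem isCompact_sparse_inter_box (n k : ℕ) (x : Fin n → ℝ) (Δ : ℝ) :
    IsCompact (sparse n k ∩ box n x Δ) := by
  rw [box_eq_Icc]
  exact isCompact_Icc.inter_left (isClosed_sparse n k)

theorem continuous_distSq {n : ℕ} (w : Fin n → ℝ) : Continuous (distSq w) := by
  unfold distSq
  fun_prop

theorem midpoint_mem_sparse {n k : ℕ} {y z : Fin n → ℝ} (hy : y ∈ sparse n k)
    (h : ∀ i, y i = 0 → z i = 0) : (fun i => (y i + z i) / 2) ∈ sparse n k := by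
  refine le_trans (Finset.card_le_card fun i hi => ?_) hy
  rw [Finset.mem_filter] at hi ⊢
  refine ⟨hi.1, fun h0 => hi.2 ?_⟩
  simp [h0, h i h0]

theorem midpoint_mem_box {n : ℕ} {x y z : Fin n → ℝ} {Δ : ℝ} (hy : y ∈ box n x Δ)
    (hz : z ∈ box n x Δ) : (fun i => (y i + z i) / 2) ∈ box n x Δ := by
  intro i
  have h₁ := abs_le.mp (hy i)
  have h₂ := abs_le.mp (hz i)
  exact abs_le.mpr ⟨by linarith, by linarith⟩

theorem distSq_midpoint {n : ℕ} (w y z : Fin n → ℝ) :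
    4 * distSq w (fun i => (y i + z i) / 2) + distSq y z =
      2 * distSq w y + 2 * distSq w z := by
  simp only [distSq, Finset.mul_sum, ← Finset.sum_add_distrib]
  exact Finset.sum_congr rfl fun i _ => by ring

theorem eq_of_distSq_nonpos {n : ℕ} {y z : Fin n → ℝ} (h : distSq y z ≤ 0) : y = z := by
  have h0 : distSq y z = 0 := le_antisymm h (Finset.sum_nonneg fun i _ => sq_nonneg _)
  funext i
  have := (Finset.sum_eq_zero_iff_of_nonneg fun i _ => sq_nonneg (y i - z i)).mp h0 i
    (Finset.mem_univ i)
  exact sub_eq_zero.mp (pow_eq_zero_iff two_ne_zero |>.mp this)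

/-- Two projections with the same support coincide. -/
theorem injOn_support_projSet {n k : ℕ} (w x : Fin n → ℝ) (Δ : ℝ) :
    Set.InjOn (fun y : Fin n → ℝ => Finset.univ.filter (fun i => y i ≠ 0))
      (projSet w (sparse n k ∩ box n x Δ)) := by
  intro y hy z hz hyz
  have hsupp : ∀ i, y i = 0 → z i = 0 := by
    intro i hi
    by_contra h
    have hmem : i ∈ Finset.univ.filter (fun i => y i ≠ 0) := by
      rw [show Finset.univ.filter (fun i => y i ≠ 0) =
        Finset.univ.filter (fun i => z i ≠ 0) from hyz]
      simpa using h
    exact (Finset.mem_filter.mp hmem).2 hi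
  have hm : (fun i => (y i + z i) / 2) ∈ sparse n k ∩ box n x Δ :=
    ⟨midpoint_mem_sparse hy.1.1 hsupp, midpoint_mem_box hy.1.2 hz.1.2⟩
  apply eq_of_distSq_nonpos
  linarith [hy.2 _ hm, hz.2 _ hm, distSq_midpoint w y z]

/-- `C = k𝔹₀ ∩ (x + Δ𝔹∞)` is nonempty and closed, and for every `w` the set
`P(w)` of projections of `w` into `C` is nonempty and finite. -/
theorem stmt13 (n k : ℕ) (hkn : k ≤ n) (Δ : ℝ) (hΔ : 0 ≤ Δ)
    (x : Fin n → ℝ) (hx : x ∈ sparse n k) :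
    (sparse n k ∩ box n x Δ).Nonempty ∧
    IsClosed (sparse n k ∩ box n x Δ) ∧
    ∀ w : Fin n → ℝ,
      (projSet w (sparse n k ∩ box n x Δ)).Nonempty ∧
      (projSet w (sparse n k ∩ box n x Δ)).Finite := by
  have hne : (sparse n k ∩ box n x Δ).Nonempty := ⟨x, hx, fun i => by simpa using hΔ⟩
  have hc := isCompact_sparse_inter_box n k x Δ
  refine ⟨hne, hc.isClosed, fun w => ⟨?_, ?_⟩⟩
  · obtain ⟨y, hy, hmin⟩ := hc.exists_isMinOn hne (continuous_distSq w).continuousOn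
    exact ⟨y, hy, fun z hz => hmin hz⟩
  · exact Set.Finite.of_finite_image (Set.toFinite _) (injOn_support_projSet w x Δ)
end
end
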